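/- Define K₀(x) = ∫₀^∞ exp(−x cosh t) dt for x > 0, and define G : ℝ² \ {0} → ℝ by G(x) = −(1/(2π)) (K₀(|x|) + log|x|). Then for every smooth compactly supported function φ : ℝ² → ℝ, one has ∫_{ℝ²} G(x) · ( Δ(Δφ)(x) − Δφ(x) ) dx = φ(0), i.e., G is a fundamental solution of the operator Δ² − Δ in two dimensions. -/

import Mathlib

noncomputable section

open Real MeasureTheory

/-- The modified Bessel function of the second kind of order zero,
`K₀(x) = ∫₀^∞ exp(−x cosh t) dt`. -/
def K0 (x : ℝ) : ℝ := ∫ t in Set.Ioi (0 : ℝ), Real.exp (-x * Real.cosh t)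

/-- The Laplacian `Δf = ∂₁²f + ∂₂²f` of a real-valued function on `ℝ²`. -/
def lap (f : EuclideanSpace ℝ (Fin 2) → ℝ) (x : EuclideanSpace ℝ (Fin 2)) : ℝ :=
  ∑ i : Fin 2,
    fderiv ℝ (fun y => fderiv ℝ f y (EuclideanSpace.single i 1)) x (EuclideanSpace.single i 1)

/-- The moments `∫₀^∞ coshⁿ t · exp(−r cosh t) dt`; `n = 0, 1` give the Bessel functions
`K₀` and `K₁`. -/
def coshMoment (n : ℕ) (r : ℝ) : ℝ :=
  ∫ t in Set.Ioi (0 : ℝ), Real.cosh t ^ n * Real.exp (-r * Real.cosh t)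

theorem coshMoment_zero (r : ℝ) : coshMoment 0 r = K0 r := by
  simp [coshMoment, K0]

theorem one_div_cosh_le (t : ℝ) : 1 / Real.cosh t ≤ 2 * Real.exp (-t) := by
  rw [div_le_iff₀ (Real.cosh_pos t), Real.cosh_eq]
  have h : Real.exp (-t) * Real.exp t = 1 := by rw [← Real.exp_add]; simp
  nlinarith [sq_nonneg (Real.exp (-t))]

theorem cosh_pow_mul_exp_le (n : ℕ) {r : ℝ} (hr : 0 < r) (t : ℝ) :
    Real.cosh t ^ n * Real.exp (-r * Real.cosh t) ≤
      (n + 1).factorial / r ^ (n + 1) * (2 * Real.exp (-t)) := by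
  have hc := Real.cosh_pos t
  have h1 : (r * Real.cosh t) ^ (n + 1) / (n + 1).factorial ≤ Real.exp (r * Real.cosh t) :=
    Real.pow_div_factorial_le_exp _ (by positivity) _
  have h2 : Real.exp (-r * Real.cosh t) ≤ (n + 1).factorial / (r * Real.cosh t) ^ (n + 1) := by
    rw [neg_mul, Real.exp_neg, ← inv_div]
    exact inv_anti₀ (by positivity) h1
  calc Real.cosh t ^ n * Real.exp (-r * Real.cosh t)
      ≤ Real.cosh t ^ n * ((n + 1).factorial / (r * Real.cosh t) ^ (n + 1)) := by gcongr
    _ = (n + 1).factorial / r ^ (n + 1) * (1 / Real.cosh t) := by field_simp; ring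
    _ ≤ _ := by gcongr; exact one_div_cosh_le t

theorem integrableOn_const_mul_exp_neg (c : ℝ) :
    IntegrableOn (fun t => c * (2 * Real.exp (-t))) (Set.Ioi 0) :=
  ((integrableOn_exp_neg_Ioi 0).const_mul 2).const_mul c

theorem integrableOn_cosh_pow_mul_exp (n : ℕ) {r : ℝ} (hr : 0 < r) :
    IntegrableOn (fun t => Real.cosh t ^ n * Real.exp (-r * Real.cosh t)) (Set.Ioi 0) := by
  refine (integrableOn_const_mul_exp_neg ((n + 1).factorial / r ^ (n + 1))).mono'
    (by fun_prop) (ae_of_all _ fun t => ?_)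
  have hc := Real.cosh_pos t
  rw [Real.norm_of_nonneg (by positivity)]
  exact cosh_pow_mul_exp_le n hr t

theorem hasDerivAt_coshMoment (n : ℕ) {r : ℝ} (hr : 0 < r) :
    HasDerivAt (coshMoment n) (-coshMoment (n + 1) r) r := by
  have key := hasDerivAt_integral_of_dominated_loc_of_deriv_le
    (F := fun r t => Real.cosh t ^ n * Real.exp (-r * Real.cosh t))
    (F' := fun r t => -(Real.cosh t ^ (n + 1) * Real.exp (-r * Real.cosh t)))
    (μ := volume.restrict (Set.Ioi 0)) (s := Set.Ioi (r / 2)) (x₀ := r)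
    (bound := fun t => (n + 1 + 1).factorial / (r / 2) ^ (n + 1 + 1) * (2 * Real.exp (-t)))
    (Ioi_mem_nhds (by linarith)) (Filter.Eventually.of_forall fun x => by fun_prop)
    (integrableOn_cosh_pow_mul_exp n hr) (by fun_prop)
    (ae_of_all _ fun t x hx => ?_) (integrableOn_const_mul_exp_neg _)
    (ae_of_all _ fun t x _ => ?_)
  · have := key.2
    rwa [integral_neg] at this
  · have hc := Real.cosh_pos t
    rw [norm_neg, Real.norm_of_nonneg (by positivity)]
    refine le_trans ?_ (cosh_pow_mul_exp_le (n + 1) (half_pos hr) t)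
    have : r / 2 < x := hx
    gcongr
  · have := (((hasDerivAt_id x).neg.mul_const (Real.cosh t)).exp.const_mul (Real.cosh t ^ n))
    convert! this using 1
    simp only [id, Pi.neg_apply]
    ring

theorem coshMoment_nonneg (n : ℕ) (r : ℝ) : 0 ≤ coshMoment n r :=
  integral_nonneg fun t => mul_nonneg (pow_nonneg (Real.cosh_pos t).le n) (Real.exp_pos _).le

theorem tendsto_cosh_mul_exp_atTop {r : ℝ} (hr : 0 < r) (n : ℕ) :
    Filter.Tendsto (fun t => Real.cosh t ^ n * Real.exp (-r * Real.cosh t)) Filter.atTop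
      (nhds 0) := by
  refine squeeze_zero (fun t => mul_nonneg (pow_nonneg (Real.cosh_pos t).le n) (Real.exp_pos _).le)
    (cosh_pow_mul_exp_le n hr) ?_
  simpa using ((Real.tendsto_exp_neg_atTop_nhds_zero.const_mul 2).const_mul
    ((n + 1).factorial / r ^ (n + 1) : ℝ))

theorem hasDerivAt_exp_neg_mul_cosh (r t : ℝ) :
    HasDerivAt (fun t => Real.exp (-r * Real.cosh t))
      (-r * Real.sinh t * Real.exp (-r * Real.cosh t)) t := by
  convert! ((Real.hasDerivAt_cosh t).const_mul (-r)).exp using 1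
  ring

/-- The second moment is determined by the lower ones, which is the Bessel equation. -/
theorem mul_coshMoment_two {r : ℝ} (hr : 0 < r) :
    r * coshMoment 2 r = r * coshMoment 0 r + coshMoment 1 r := by
  have hi := fun n => integrableOn_cosh_pow_mul_exp n hr
  have hi' : IntegrableOn (fun t => r * (Real.cosh t ^ 2 * Real.exp (-r * Real.cosh t)) -
      r * (Real.cosh t ^ 0 * Real.exp (-r * Real.cosh t))) (Set.Ioi 0) :=
    ((hi 2).const_mul r).sub ((hi 0).const_mul r)
  have hint : IntegrableOn (fun t => r * (Real.cosh t ^ 2 * Real.exp (-r * Real.cosh t)) -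
      r * (Real.cosh t ^ 0 * Real.exp (-r * Real.cosh t)) -
      Real.cosh t ^ 1 * Real.exp (-r * Real.cosh t)) (Set.Ioi 0) := hi'.sub (hi 1)
  have h := integral_Ioi_of_hasDerivAt_of_tendsto'
    (f := fun t => -(Real.sinh t * Real.exp (-r * Real.cosh t))) (m := 0) (a := 0)
    (fun t _ => ?_) hint ?_
  · rw [integral_sub hi' (hi 1),
      integral_sub ((hi 2).const_mul r) ((hi 0).const_mul r), integral_const_mul,
      integral_const_mul] at h
    simp only [Real.sinh_zero, zero_mul, neg_zero, sub_zero] at h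
    simp only [coshMoment]
    linarith
  · convert! ((Real.hasDerivAt_sinh t).mul (hasDerivAt_exp_neg_mul_cosh r t)).neg using 1
    rw [Real.cosh_sq]
    ring
  · refine squeeze_zero_norm (fun t => ?_) (tendsto_cosh_mul_exp_atTop hr 1)
    rw [norm_neg, norm_mul, Real.norm_eq_abs, Real.norm_of_nonneg (Real.exp_pos _).le, pow_one]
    gcongr
    rw [abs_le]
    constructor <;> rw [Real.sinh_eq, Real.cosh_eq] <;>
      linarith [Real.exp_pos t, Real.exp_pos (-t)]

theorem hasDerivAt_mul_coshMoment_one {r : ℝ} (hr : 0 < r) :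
    HasDerivAt (fun r => r * coshMoment 1 r) (-(r * coshMoment 0 r)) r := by
  convert! (hasDerivAt_id r).mul (hasDerivAt_coshMoment 1 hr) using 1
  have := mul_coshMoment_two hr
  simp only [id]
  linarith

theorem mul_coshMoment_one_mem {r : ℝ} (hr : 0 < r) :
    r * coshMoment 1 r ∈ Set.Icc (Real.exp (-r)) (Real.exp (-r) + r) := by
  have hi := fun n => integrableOn_cosh_pow_mul_exp n hr
  have hle : ∀ t : ℝ, Real.exp (-t) * Real.exp (-r * Real.cosh t) ≤ Real.exp (-t) := fun t =>
    mul_le_of_le_one_right (Real.exp_pos _).le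
      (Real.exp_le_one_iff.2 (by nlinarith [Real.cosh_pos t]))
  have hj : IntegrableOn (fun t => Real.exp (-t) * Real.exp (-r * Real.cosh t)) (Set.Ioi 0) := by
    refine (integrableOn_exp_neg_Ioi 0).mono' (by fun_prop) (ae_of_all _ fun t => ?_)
    rw [Real.norm_of_nonneg (by positivity)]
    exact hle t
  have hint : IntegrableOn (fun t => r * (Real.cosh t ^ 1 * Real.exp (-r * Real.cosh t)) -
      r * (Real.exp (-t) * Real.exp (-r * Real.cosh t))) (Set.Ioi 0) :=
    ((hi 1).const_mul r).sub (hj.const_mul r)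
  have h := integral_Ioi_of_hasDerivAt_of_tendsto'
    (f := fun t => -Real.exp (-r * Real.cosh t)) (m := 0) (a := 0)
    (fun t _ => ?_) hint ?_
  · rw [integral_sub ((hi 1).const_mul r) (hj.const_mul r), integral_const_mul,
      integral_const_mul] at h
    simp only [Real.cosh_zero, mul_one, zero_sub, neg_neg] at h
    have h0 : 0 ≤ ∫ t in Set.Ioi (0 : ℝ), Real.exp (-t) * Real.exp (-r * Real.cosh t) :=
      integral_nonneg fun t => by positivity
    have h1 : ∫ t in Set.Ioi (0 : ℝ), Real.exp (-t) * Real.exp (-r * Real.cosh t) ≤ 1 := by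
      rw [← integral_exp_neg_Ioi_zero]
      exact integral_mono hj (integrableOn_exp_neg_Ioi 0) hle
    simp only [coshMoment, Set.mem_Icc]
    constructor <;> nlinarith
  · convert! (hasDerivAt_exp_neg_mul_cosh r t).neg using 1
    have : Real.cosh t - Real.exp (-t) = Real.sinh t := by
      rw [Real.sinh_eq, Real.cosh_eq]; ring
    rw [← this]
    ring
  · simpa using (tendsto_cosh_mul_exp_atTop hr 0).neg

theorem tendsto_mul_coshMoment_one :
    Filter.Tendsto (fun r => r * coshMoment 1 r) (nhdsWithin 0 (Set.Ioi 0)) (nhds 1) := by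
  have h : ∀ f : ℝ → ℝ, Continuous f → f 0 = 1 →
      Filter.Tendsto f (nhdsWithin 0 (Set.Ioi 0)) (nhds 1) := fun f hf h0 =>
    h0 ▸ (hf.tendsto 0).mono_left nhdsWithin_le_nhds
  refine tendsto_of_tendsto_of_tendsto_of_le_of_le' (h (fun r => Real.exp (-r)) (by fun_prop)
    (by simp)) (h (fun r => Real.exp (-r) + r) (by fun_prop) (by simp)) ?_ ?_
  · filter_upwards [self_mem_nhdsWithin] with r hr using (mul_coshMoment_one_mem hr).1
  · filter_upwards [self_mem_nhdsWithin] with r hr using (mul_coshMoment_one_mem hr).2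

theorem mul_exp_neg_mul_cosh_le {r : ℝ} (hr : 0 < r) (t : ℝ) :
    r * Real.exp (-r * Real.cosh t) ≤ 2 * Real.exp (-t) := by
  have h := cosh_pow_mul_exp_le 0 hr t
  have := mul_le_mul_of_nonneg_left h hr.le
  simp only [pow_zero, one_mul, zero_add, Nat.factorial_one, Nat.cast_one, pow_one] at this
  rwa [← mul_assoc r (1 / r), mul_one_div_cancel hr.ne', one_mul] at this

theorem mul_coshMoment_zero_le {r : ℝ} (hr : 0 < r) : r * coshMoment 0 r ≤ 2 := by
  have h : ∫ t in Set.Ioi (0 : ℝ), 2 * Real.exp (-t) = 2 := by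
    rw [integral_const_mul, integral_exp_neg_Ioi_zero, mul_one]
  rw [coshMoment, ← integral_const_mul]
  simp only [pow_zero, one_mul]
  refine le_trans (integral_mono ?_ ((integrableOn_exp_neg_Ioi 0).const_mul 2)
    (mul_exp_neg_mul_cosh_le hr)) h.le
  simpa using (integrableOn_cosh_pow_mul_exp 0 hr).const_mul r

theorem tendsto_mul_coshMoment_zero :
    Filter.Tendsto (fun r => r * coshMoment 0 r) (nhdsWithin 0 (Set.Ioi 0)) (nhds 0) := by
  have h := tendsto_integral_filter_of_dominated_convergence (μ := volume.restrict (Set.Ioi 0))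
    (l := nhdsWithin 0 (Set.Ioi 0)) (F := fun r t => r * Real.exp (-r * Real.cosh t))
    (f := fun _ => 0) (fun t => 2 * Real.exp (-t))
    (Filter.Eventually.of_forall fun r => by fun_prop) ?_
    ((integrableOn_exp_neg_Ioi 0).const_mul 2) (ae_of_all _ fun t => ?_)
  · simpa [coshMoment, integral_const_mul] using h
  · filter_upwards [self_mem_nhdsWithin] with r hr
    refine ae_of_all _ fun t => ?_
    have : (0 : ℝ) < r := hr
    rw [Real.norm_of_nonneg (by positivity)]
    exact mul_exp_neg_mul_cosh_le hr t
  · have hc : Continuous fun r : ℝ => r * Real.exp (-r * Real.cosh t) := by fun_prop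
    simpa using (hc.tendsto 0).mono_left nhdsWithin_le_nhds

theorem hasDerivAt_intervalIntegral_of_continuous {f f' : ℝ → ℝ → ℝ} {a b : ℝ}
    (hf : Continuous (Function.uncurry f)) (hf' : Continuous (Function.uncurry f'))
    (h : ∀ r θ, HasDerivAt (fun r => f r θ) (f' r θ) r) (r : ℝ) :
    HasDerivAt (fun r => ∫ θ in a..b, f r θ) (∫ θ in a..b, f' r θ) r := by
  obtain ⟨C, hC⟩ := ((isCompact_closedBall r 1).prod (isCompact_uIcc (a := a) (b := b))).bddAbove_image
    hf'.norm.continuousOn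
  have hcont : ∀ r, Continuous (f r) := fun r => hf.comp (Continuous.prodMk_right r)
  have hcont' : ∀ r, Continuous (f' r) := fun r => hf'.comp (Continuous.prodMk_right r)
  refine (intervalIntegral.hasDerivAt_integral_of_dominated_loc_of_deriv_le
    (s := Metric.closedBall r 1) (bound := fun _ => C)
    (Metric.closedBall_mem_nhds r one_pos)
    (Filter.Eventually.of_forall fun r => (hcont r).aestronglyMeasurable)
    ((hcont r).intervalIntegrable _ _) (hcont' r).aestronglyMeasurable
    (ae_of_all _ fun θ hθ x hx => hC ⟨(x, θ), ⟨hx, Set.uIoc_subset_uIcc hθ⟩, rfl⟩)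
    intervalIntegrable_const (ae_of_all _ fun θ _ x _ => h x θ)).2

/-- The point of the unit circle at angle `θ`. -/
def circleDir (θ : ℝ) : EuclideanSpace ℝ (Fin 2) :=
  Real.cos θ • EuclideanSpace.single 0 1 + Real.sin θ • EuclideanSpace.single 1 1

/-- The unit tangent vector to the unit circle at angle `θ`. -/
def circleTangent (θ : ℝ) : EuclideanSpace ℝ (Fin 2) :=
  -Real.sin θ • EuclideanSpace.single 0 1 + Real.cos θ • EuclideanSpace.single 1 1

@[fun_prop]
theorem continuous_circleDir : Continuous circleDir := by
  unfold circleDir; fun_prop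

@[fun_prop]
theorem continuous_circleTangent : Continuous circleTangent := by
  unfold circleTangent; fun_prop

theorem hasDerivAt_circleDir (θ : ℝ) : HasDerivAt circleDir (circleTangent θ) θ :=
  ((Real.hasDerivAt_cos θ).smul_const _).add ((Real.hasDerivAt_sin θ).smul_const _)

theorem hasDerivAt_circleTangent (θ : ℝ) : HasDerivAt circleTangent (-circleDir θ) θ := by
  have h := ((Real.hasDerivAt_sin θ).neg.smul_const
    (EuclideanSpace.single (0 : Fin 2) (1 : ℝ))).add
    ((Real.hasDerivAt_cos θ).smul_const (EuclideanSpace.single (1 : Fin 2) (1 : ℝ)))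
  rwa [neg_smul, neg_smul, ← neg_add] at h

theorem norm_circleDir (θ : ℝ) : ‖circleDir θ‖ = 1 := by
  simp [circleDir, EuclideanSpace.norm_eq]

theorem norm_smul_circleDir {r : ℝ} (hr : 0 ≤ r) (θ : ℝ) : ‖r • circleDir θ‖ = r := by
  rw [norm_smul, norm_circleDir, mul_one, Real.norm_of_nonneg hr]

/-- The integral of `f` over the circle of radius `r`, with respect to the angle. -/
def circleMean (f : EuclideanSpace ℝ (Fin 2) → ℝ) (r : ℝ) : ℝ :=
  ∫ θ in -π..π, f (r • circleDir θ)

/-- The angular integral of the radial derivative of `f`. -/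
def circleMeanDeriv (f : EuclideanSpace ℝ (Fin 2) → ℝ) (r : ℝ) : ℝ :=
  ∫ θ in -π..π, fderiv ℝ f (r • circleDir θ) (circleDir θ)

theorem hasDerivAt_circleMean {f : EuclideanSpace ℝ (Fin 2) → ℝ} (hf : ContDiff ℝ 1 f) (r : ℝ) :
    HasDerivAt (circleMean f) (circleMeanDeriv f r) r := by
  have hd := hf.differentiable one_ne_zero
  have hc := hf.continuous
  have hc' := hf.continuous_fderiv one_ne_zero
  refine hasDerivAt_intervalIntegral_of_continuous
    (f := fun r θ => f (r • circleDir θ))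
    (f' := fun r θ => fderiv ℝ f (r • circleDir θ) (circleDir θ)) ?_ ?_ (fun r θ => ?_) r
  · unfold Function.uncurry; fun_prop
  · unfold Function.uncurry; fun_prop
  · have h := (hd (r • circleDir θ)).hasFDerivAt.comp_hasDerivAt r
      ((hasDerivAt_id r).smul_const (circleDir θ))
    simpa using! h

theorem hasDerivAt_circleMeanDeriv {f : EuclideanSpace ℝ (Fin 2) → ℝ} (hf : ContDiff ℝ 2 f)
    (r : ℝ) :
    HasDerivAt (circleMeanDeriv f)
      (∫ θ in -π..π, fderiv ℝ (fderiv ℝ f) (r • circleDir θ) (circleDir θ) (circleDir θ)) r := by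
  have hf' : ContDiff ℝ 1 (fderiv ℝ f) := hf.fderiv_right (by norm_num)
  have hd := hf'.differentiable one_ne_zero
  have hc := hf'.continuous
  have hc' := hf'.continuous_fderiv one_ne_zero
  refine hasDerivAt_intervalIntegral_of_continuous
    (f := fun r θ => fderiv ℝ f (r • circleDir θ) (circleDir θ))
    (f' := fun r θ => fderiv ℝ (fderiv ℝ f) (r • circleDir θ) (circleDir θ) (circleDir θ))
    ?_ ?_ (fun r θ => ?_) r
  · unfold Function.uncurry; fun_prop
  · unfold Function.uncurry; fun_prop
  · have hs : HasDerivAt (fun r : ℝ => r • circleDir θ) (circleDir θ) r := by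
      simpa using! (hasDerivAt_id r).smul_const (circleDir θ)
    have h : HasDerivAt (fun r : ℝ => fderiv ℝ f (r • circleDir θ))
        (fderiv ℝ (fderiv ℝ f) (r • circleDir θ) (circleDir θ)) r :=
      (hd (r • circleDir θ)).hasFDerivAt.comp_hasDerivAt r hs
    simpa using h.clm_apply (hasDerivAt_const r (circleDir θ))

theorem lap_eq_sum {f : EuclideanSpace ℝ (Fin 2) → ℝ} (hf : ContDiff ℝ 2 f)
    (x : EuclideanSpace ℝ (Fin 2)) :
    lap f x = ∑ i : Fin 2, fderiv ℝ (fderiv ℝ f) x (EuclideanSpace.single i 1)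
      (EuclideanSpace.single i 1) := by
  have hf' : ContDiff ℝ 1 (fderiv ℝ f) := hf.fderiv_right (by norm_num)
  refine Finset.sum_congr rfl fun i _ => ?_
  rw [fderiv_clm_apply (hf'.differentiable one_ne_zero x) (differentiableAt_const _)]
  simp

theorem lap_eq_circle {f : EuclideanSpace ℝ (Fin 2) → ℝ} (hf : ContDiff ℝ 2 f)
    (x : EuclideanSpace ℝ (Fin 2)) (θ : ℝ) :
    lap f x = fderiv ℝ (fderiv ℝ f) x (circleDir θ) (circleDir θ) +
      fderiv ℝ (fderiv ℝ f) x (circleTangent θ) (circleTangent θ) := by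
  rw [lap_eq_sum hf, Fin.sum_univ_two]
  simp only [circleDir, circleTangent, map_add, map_smul, add_apply, smul_apply, smul_eq_mul]
  linear_combination -(fderiv ℝ (fderiv ℝ f) x (EuclideanSpace.single 0 1)
    (EuclideanSpace.single 0 1) + fderiv ℝ (fderiv ℝ f) x (EuclideanSpace.single 1 1)
    (EuclideanSpace.single 1 1)) * Real.sin_sq_add_cos_sq θ

theorem continuous_lap {f : EuclideanSpace ℝ (Fin 2) → ℝ} (hf : ContDiff ℝ 2 f) :
    Continuous (lap f) := by
  have hf' : ContDiff ℝ 1 (fderiv ℝ f) := hf.fderiv_right (by norm_num)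
  have hc' := hf'.continuous_fderiv one_ne_zero
  rw [funext (lap_eq_sum hf)]
  fun_prop

theorem contDiff_lap {f : EuclideanSpace ℝ (Fin 2) → ℝ} (hf : ContDiff ℝ (⊤ : ℕ∞) f) :
    ContDiff ℝ (⊤ : ℕ∞) (lap f) := by
  unfold lap
  refine ContDiff.sum fun i _ => ?_
  have h1 : ContDiff ℝ (⊤ : ℕ∞) fun y => fderiv ℝ f y (EuclideanSpace.single i 1) :=
    (hf.fderiv_right (by simp)).clm_apply contDiff_const
  exact (h1.fderiv_right (by simp)).clm_apply contDiff_const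

/-- The angular average of the Laplacian is the radial Laplacian of the angular average. -/
theorem hasDerivAt_mul_circleMeanDeriv {f : EuclideanSpace ℝ (Fin 2) → ℝ} (hf : ContDiff ℝ 2 f)
    (r : ℝ) :
    HasDerivAt (fun r => r * circleMeanDeriv f r) (r * circleMean (lap f) r) r := by
  have hf' : ContDiff ℝ 1 (fderiv ℝ f) := hf.fderiv_right (by norm_num)
  have hd := hf'.differentiable one_ne_zero
  have hc := hf'.continuous
  have hc' := hf'.continuous_fderiv one_ne_zero
  have hT : ∫ θ in -π..π, (r * fderiv ℝ (fderiv ℝ f) (r • circleDir θ) (circleTangent θ)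
      (circleTangent θ) - fderiv ℝ f (r • circleDir θ) (circleDir θ)) = 0 := by
    rw [intervalIntegral.integral_eq_sub_of_hasDerivAt
      (f := fun θ => fderiv ℝ f (r • circleDir θ) (circleTangent θ)) (fun θ _ => ?_)
      (Continuous.intervalIntegrable (by fun_prop) _ _)]
    · simp [circleDir, circleTangent]
    · have hs : HasDerivAt (fun θ => r • circleDir θ) (r • circleTangent θ) θ :=
        (hasDerivAt_circleDir θ).const_smul r
      have h : HasDerivAt (fun θ => fderiv ℝ f (r • circleDir θ))
          (fderiv ℝ (fderiv ℝ f) (r • circleDir θ) (r • circleTangent θ)) θ :=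
        (hd (r • circleDir θ)).hasFDerivAt.comp_hasDerivAt θ hs
      simpa [sub_eq_add_neg] using h.clm_apply (hasDerivAt_circleTangent θ)
  convert! (hasDerivAt_id r).mul (hasDerivAt_circleMeanDeriv hf r) using 1
  have hsplit : r * circleMean (lap f) r =
      r * (∫ θ in -π..π, fderiv ℝ (fderiv ℝ f) (r • circleDir θ) (circleDir θ) (circleDir θ)) +
      r * (∫ θ in -π..π, fderiv ℝ (fderiv ℝ f) (r • circleDir θ) (circleTangent θ)
        (circleTangent θ)) := by
    rw [← mul_add, ← intervalIntegral.integral_add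
      (Continuous.intervalIntegrable (by fun_prop) _ _)
      (Continuous.intervalIntegrable (by fun_prop) _ _)]
    rw [circleMean]
    congr 1
    exact intervalIntegral.integral_congr fun θ _ => lap_eq_circle hf _ θ
  rw [intervalIntegral.integral_sub (Continuous.intervalIntegrable (by fun_prop) _ _)
      (Continuous.intervalIntegrable (by fun_prop) _ _), intervalIntegral.integral_const_mul] at hT
  rw [hsplit]
  simp only [id, circleMeanDeriv]
  linarith

theorem tsupport_lap_subset (f : EuclideanSpace ℝ (Fin 2) → ℝ) : tsupport (lap f) ⊆ tsupport f := by
  refine closure_minimal (fun x hx => ?_) (isClosed_tsupport f)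
  by_contra hxf
  refine hx (Finset.sum_eq_zero fun i _ => ?_)
  have hsub : tsupport (fun y => fderiv ℝ f y (EuclideanSpace.single i 1)) ⊆ tsupport f :=
    tsupport_fderiv_apply_subset ℝ _
  rw [fderiv_of_notMem_tsupport ℝ fun h => hxf (hsub h)]
  rfl

theorem integral_eq_integral_polar (h : EuclideanSpace ℝ (Fin 2) → ℝ) :
    ∫ x, h x = ∫ p in Set.Ioi (0 : ℝ) ×ˢ Set.Ioo (-π) π, p.1 * h (p.1 • circleDir p.2) := by
  rw [← (EuclideanSpace.volume_preserving_symm_measurableEquiv_toLp (Fin 2)).symm.integral_comp'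
      h,
    ← (volume_preserving_finTwoArrow ℝ).symm.integral_comp', ← integral_comp_polarCoord_symm]
  refine setIntegral_congr_fun (by measurability) fun p _ => ?_
  simp only [smul_eq_mul]
  congr 2
  ext i
  fin_cases i <;> simp [circleDir]

theorem circleMean_eq_zero {f : EuclideanSpace ℝ (Fin 2) → ℝ} {r : ℝ}
    (h : ∀ θ, r • circleDir θ ∉ tsupport f) : circleMean f r = 0 := by
  simp [circleMean, fun θ => image_eq_zero_of_notMem_tsupport (h θ)]

theorem circleMeanDeriv_eq_zero {f : EuclideanSpace ℝ (Fin 2) → ℝ} {r : ℝ}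
    (h : ∀ θ, r • circleDir θ ∉ tsupport f) : circleMeanDeriv f r = 0 := by
  simp [circleMeanDeriv, fun θ => fderiv_of_notMem_tsupport ℝ (h θ)]

theorem integrableOn_polar {f : EuclideanSpace ℝ (Fin 2) → ℝ} (hf : Continuous f) {R : ℝ}
    (hR : ∀ r, R < r → ∀ θ, f (r • circleDir θ) = 0) :
    IntegrableOn (fun p : ℝ × ℝ => (p.1 * coshMoment 0 p.1 + p.1 * Real.log p.1) *
      f (p.1 • circleDir p.2)) (Set.Ioi (0 : ℝ) ×ˢ Set.Ioo (-π) π) := by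
  obtain ⟨B, hB⟩ := ((isCompact_Icc (a := (0 : ℝ)) (b := R)).prod
    (isCompact_Icc (a := -π) (b := π))).bddAbove_image
    (f := fun p : ℝ × ℝ => ‖f (p.1 • circleDir p.2)‖) (by fun_prop)
  obtain ⟨L, hL⟩ := (isCompact_Icc (a := (0 : ℝ)) (b := R)).bddAbove_image
    (f := fun r => ‖r * Real.log r‖) (Real.continuous_mul_log.norm.continuousOn)
  have hcont : ContinuousOn (fun p : ℝ × ℝ => (p.1 * coshMoment 0 p.1 + p.1 * Real.log p.1) *
      f (p.1 • circleDir p.2)) (Set.Ioi (0 : ℝ) ×ˢ Set.Ioo (-π) π) := by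
    have h0 : ContinuousOn (coshMoment 0) (Set.Ioi 0) := fun r hr =>
      (hasDerivAt_coshMoment 0 hr).continuousAt.continuousWithinAt
    have h1 : ContinuousOn (fun p : ℝ × ℝ => coshMoment 0 p.1)
        (Set.Ioi (0 : ℝ) ×ˢ Set.Ioo (-π) π) :=
      h0.comp continuousOn_fst fun p hp => hp.1
    have h2 : Continuous fun p : ℝ × ℝ => p.1 * Real.log p.1 :=
      Real.continuous_mul_log.comp continuous_fst
    have h3 : Continuous fun p : ℝ × ℝ => f (p.1 • circleDir p.2) := by fun_prop
    exact ((continuousOn_fst.mul h1).add h2.continuousOn).mul h3.continuousOn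
  have hsub : Set.Ioc (0 : ℝ) R ×ˢ Set.Ioo (-π) π ⊆ Set.Ioi (0 : ℝ) ×ˢ Set.Ioo (-π) π :=
    Set.prod_mono Set.Ioc_subset_Ioi_self le_rfl
  have hmeas : MeasurableSet (Set.Ioc (0 : ℝ) R ×ˢ Set.Ioo (-π) π) :=
    measurableSet_Ioc.prod measurableSet_Ioo
  have hmeas' : MeasurableSet (Set.Ioi (0 : ℝ) ×ˢ Set.Ioo (-π) π) :=
    measurableSet_Ioi.prod measurableSet_Ioo
  have hint : IntegrableOn (fun p : ℝ × ℝ => (p.1 * coshMoment 0 p.1 + p.1 * Real.log p.1) *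
      f (p.1 • circleDir p.2)) (Set.Ioc (0 : ℝ) R ×ˢ Set.Ioo (-π) π) := by
    refine IntegrableOn.of_bound ?_ ((hcont.mono hsub).aestronglyMeasurable hmeas)
      ((2 + L) * B) ((ae_restrict_mem hmeas).mono fun p hp => ?_)
    · rw [Measure.volume_eq_prod, Measure.prod_prod]
      simp [ENNReal.mul_lt_top]
    · have hp1 : 0 < p.1 := hp.1.1
      rw [norm_mul]
      have hBp := hB ⟨p, ⟨⟨hp1.le, hp.1.2⟩, Set.Ioo_subset_Icc_self hp.2⟩, rfl⟩
      have hLp := hL ⟨p.1, ⟨hp1.le, hp.1.2⟩, rfl⟩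
      have h0 : ‖p.1 * coshMoment 0 p.1‖ ≤ 2 := by
        rw [Real.norm_of_nonneg (mul_nonneg hp1.le (coshMoment_nonneg _ _))]
        exact mul_coshMoment_zero_le hp1
      exact mul_le_mul ((norm_add_le _ _).trans (add_le_add h0 hLp)) hBp (norm_nonneg _)
        (add_nonneg zero_le_two ((norm_nonneg _).trans hLp))
  refine hint.of_forall_sdiff_eq_zero hmeas' fun p hp => ?_
  have : R < p.1 := not_le.1 fun h => hp.2 ⟨⟨hp.1.1, h⟩, hp.1.2⟩
  rw [hR _ this, mul_zero]

theorem circleMean_zero (f : EuclideanSpace ℝ (Fin 2) → ℝ) : circleMean f 0 = 2 * π * f 0 := by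
  simp only [circleMean, zero_smul, intervalIntegral.integral_const, smul_eq_mul]
  ring

theorem integral_radial_mul_circleMean {φ : EuclideanSpace ℝ (Fin 2) → ℝ}
    (hφ : ContDiff ℝ (⊤ : ℕ∞) φ) {R : ℝ}
    (hR : ∀ r, R < r → ∀ θ, r • circleDir θ ∉ tsupport φ)
    (hint : IntegrableOn (fun r => (coshMoment 0 r + Real.log r) *
      (r * circleMean (lap (lap φ)) r - r * circleMean (lap φ) r)) (Set.Ioi 0)) :
    ∫ r in Set.Ioi (0 : ℝ), (coshMoment 0 r + Real.log r) *
      (r * circleMean (lap (lap φ)) r - r * circleMean (lap φ) r) = -(2 * π * φ 0) := by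
  have hw := contDiff_lap hφ
  have hφ2 : ContDiff ℝ 2 φ := mod_cast contDiff_infty.1 hφ 2
  have hφ1 : ContDiff ℝ 1 φ := mod_cast contDiff_infty.1 hφ 1
  have hw2 : ContDiff ℝ 2 (lap φ) := mod_cast contDiff_infty.1 hw 2
  have hw1 : ContDiff ℝ 1 (lap φ) := mod_cast contDiff_infty.1 hw 1
  set F : ℝ → ℝ := fun r => (coshMoment 0 r + Real.log r) * (r * circleMeanDeriv (lap φ) r) -
    (1 - r * coshMoment 1 r) * circleMean (lap φ) r -
    Real.log r * (r * circleMeanDeriv φ r) + circleMean φ r with hF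
  have hderiv : ∀ r ∈ Set.Ioi (0 : ℝ), HasDerivAt F ((coshMoment 0 r + Real.log r) *
      (r * circleMean (lap (lap φ)) r - r * circleMean (lap φ) r)) r := by
    intro r hr
    have hr' : (0 : ℝ) < r := hr
    have hlog := Real.hasDerivAt_log hr'.ne'
    convert! ((((hasDerivAt_coshMoment 0 hr').add hlog).mul
      (hasDerivAt_mul_circleMeanDeriv hw2 r)).sub
      (((hasDerivAt_mul_coshMoment_one hr').const_sub 1).mul (hasDerivAt_circleMean hw1 r))).sub
      (hlog.mul (hasDerivAt_mul_circleMeanDeriv hφ2 r)) |>.add (hasDerivAt_circleMean hφ1 r) using 1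
    simp only [Pi.add_apply, zero_add]
    field_simp
    ring
  have htop : Filter.Tendsto F Filter.atTop (nhds 0) := by
    refine tendsto_const_nhds.congr' ?_
    filter_upwards [Filter.eventually_gt_atTop R] with r hr
    have hr' := hR r hr
    have hr'' : ∀ θ, r • circleDir θ ∉ tsupport (lap φ) := fun θ h =>
      hr' θ (tsupport_lap_subset φ h)
    simp [hF, circleMean_eq_zero hr', circleMean_eq_zero hr'', circleMeanDeriv_eq_zero hr',
      circleMeanDeriv_eq_zero hr'']
  have hzero : Filter.Tendsto F (nhdsWithin 0 (Set.Ioi 0)) (nhds (circleMean φ 0)) := by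
    have hc : ∀ {f : ℝ → ℝ}, ContinuousAt f 0 →
        Filter.Tendsto f (nhdsWithin 0 (Set.Ioi 0)) (nhds (f 0)) := fun h =>
      h.tendsto.mono_left nhdsWithin_le_nhds
    have hlog : Filter.Tendsto (fun r : ℝ => r * Real.log r) (nhdsWithin 0 (Set.Ioi 0))
        (nhds 0) := by simpa using hc Real.continuous_mul_log.continuousAt
    have h := ((((tendsto_mul_coshMoment_zero.add hlog).mul
      (hc (hasDerivAt_circleMeanDeriv hw2 0).continuousAt)).sub
      ((tendsto_mul_coshMoment_one.const_sub 1).mul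
        (hc (hasDerivAt_circleMean hw1 0).continuousAt))).sub
      (hlog.mul (hc (hasDerivAt_circleMeanDeriv hφ2 0).continuousAt))).add
      (hc (hasDerivAt_circleMean hφ1 0).continuousAt)
    simp only [add_zero, zero_mul, sub_self, zero_add] at h
    refine h.congr fun r => ?_
    simp only [hF]
    ring
  have h := integral_Ioi_deriv_mul_eq_sub (u := F) (v := fun _ => (1 : ℝ)) (v' := fun _ => 0)
    hderiv (fun r _ => hasDerivAt_const r 1) (by simpa [Pi.mul_def, Pi.add_def] using hint)
    (by simpa [Pi.mul_def] using hzero) (by simpa [Pi.mul_def] using htop)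
  simp only [mul_one, mul_zero, add_zero] at h
  rw [h, circleMean_zero, zero_sub]

/-- `G(x) = −(1/(2π)) (K₀(|x|) + log|x|)` is a fundamental solution of `Δ² − Δ`
in two dimensions: for every smooth compactly supported `φ`,
`∫ G(x) (Δ(Δφ)(x) − Δφ(x)) dx = φ(0)`. -/
theorem G_fundamental_solution_bilaplacian
    (φ : EuclideanSpace ℝ (Fin 2) → ℝ) (hφ : ContDiff ℝ (⊤ : ℕ∞) φ) (hsupp : HasCompactSupport φ)
    (G : EuclideanSpace ℝ (Fin 2) → ℝ)
    (hG : ∀ x : EuclideanSpace ℝ (Fin 2), x ≠ 0 →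
      G x = -(1 / (2 * Real.pi)) * (K0 ‖x‖ + Real.log ‖x‖)) :
    ∫ x : EuclideanSpace ℝ (Fin 2), G x * (lap (lap φ) x - lap φ x) = φ 0 := by
  have hw := contDiff_lap hφ
  have hφ2 : ContDiff ℝ 2 φ := mod_cast contDiff_infty.1 hφ 2
  have hw2 : ContDiff ℝ 2 (lap φ) := mod_cast contDiff_infty.1 hw 2
  have hc1 := continuous_lap hφ2
  have hc2 := continuous_lap hw2
  obtain ⟨R, hR0, hRs⟩ := hsupp.isCompact.isBounded.subset_closedBall_lt 0 0
  have hR : ∀ r, R < r → ∀ θ, r • circleDir θ ∉ tsupport φ := fun r hr θ h => by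
    have := mem_closedBall_zero_iff.1 (hRs h)
    rw [norm_smul_circleDir (hR0.trans hr).le] at this
    exact absurd hr this.not_gt
  have hf0 : ∀ r, R < r → ∀ θ, (fun x => lap (lap φ) x - lap φ x) (r • circleDir θ) = 0 :=
    fun r hr θ => by
      have h1 := fun h => hR r hr θ (tsupport_lap_subset φ h)
      have h2 := fun h => h1 (tsupport_lap_subset (lap φ) h)
      simp [image_eq_zero_of_notMem_tsupport h1, image_eq_zero_of_notMem_tsupport h2]
  have hc : Continuous fun x => lap (lap φ) x - lap φ x := hc2.sub hc1
  have hint := integrableOn_polar hc hf0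
  have hinner : ∀ r : ℝ, ∫ θ in Set.Ioo (-π) π, (r * coshMoment 0 r + r * Real.log r) *
      (fun x => lap (lap φ) x - lap φ x) (r • circleDir θ) = (coshMoment 0 r + Real.log r) *
      (r * circleMean (lap (lap φ)) r - r * circleMean (lap φ) r) := fun r => by
    rw [integral_const_mul, ← integral_Ioc_eq_integral_Ioo,
      ← intervalIntegral.integral_of_le (by linarith [Real.pi_pos]),
      intervalIntegral.integral_sub (Continuous.intervalIntegrable (by fun_prop) _ _)
        (Continuous.intervalIntegrable (by fun_prop) _ _)]
    simp only [circleMean]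
    ring
  have hint_r : IntegrableOn (fun r => (coshMoment 0 r + Real.log r) *
      (r * circleMean (lap (lap φ)) r - r * circleMean (lap φ) r)) (Set.Ioi 0) := by
    have h := hint
    rw [IntegrableOn, Measure.volume_eq_prod, ← Measure.prod_restrict] at h
    exact h.integral_prod_left.congr (ae_of_all _ hinner)
  have hG' : ∀ p ∈ Set.Ioi (0 : ℝ) ×ˢ Set.Ioo (-π) π,
      p.1 * (G (p.1 • circleDir p.2) * (lap (lap φ) (p.1 • circleDir p.2) -
        lap φ (p.1 • circleDir p.2))) = -(1 / (2 * π)) *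
      ((p.1 * coshMoment 0 p.1 + p.1 * Real.log p.1) *
        (fun x => lap (lap φ) x - lap φ x) (p.1 • circleDir p.2)) := fun p hp => by
    have hp1 : 0 < p.1 := hp.1
    have hn := norm_smul_circleDir hp1.le p.2
    rw [hG _ (norm_pos_iff.1 (hp1.trans_eq hn.symm)), hn, ← coshMoment_zero]
    ring
  rw [integral_eq_integral_polar,
    setIntegral_congr_fun (measurableSet_Ioi.prod measurableSet_Ioo) hG', integral_const_mul,
    Measure.volume_eq_prod, setIntegral_prod _ hint]
  simp only [hinner]
  rw [integral_radial_mul_circleMean hφ hR hint_r]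
  field_simp
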